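/- Let β > 0 and 0 < V₀ < 1/(2√β), set x* = √(1 − 2√β·V₀), ℏ* = E(x*), and for ℏ ∈ (0, ℏ*) let x₊(ℏ) ∈ (0, x*) be the unique root of E(x) = ℏ and T(ℏ) = 2√2 ∫₀^{x₊(ℏ)} (ℏ − E(x))^{−1/2} dx. Then for every ℏ ∈ (0, ℏ*), T(ℏ) = 2√2 ∫₀¹ (1 − ρ²)^{−1/2} · (1/2 − 2βV₀²/((1 − ρ²·x₊(ℏ)²)(1 − x₊(ℏ)²)))^{−1/2} dρ. -/

import Mathlib

/-- change of variables formula for the period function. -/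
theorem combDrive_period_substitution (β V₀ : ℝ) (hβ : 0 < β) (hV0 : 0 < V₀)
    (hV1 : V₀ < 1 / (2 * Real.sqrt β))
    (xstar : ℝ) (hxstar : xstar = Real.sqrt (1 - 2 * Real.sqrt β * V₀))
    (E : ℝ → ℝ)
    (hE : ∀ x, E x = x ^ 2 / 2 - 2 * β * V₀ ^ 2 / (1 - x ^ 2) + 2 * β * V₀ ^ 2)
    (hstar : ℝ) (hhstar : hstar = E xstar)
    (xp : ℝ → ℝ)
    (hxp : ∀ ℏ ∈ Set.Ioo (0 : ℝ) hstar, xp ℏ ∈ Set.Ioo 0 xstar ∧ E (xp ℏ) = ℏ)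
    (T : ℝ → ℝ)
    (hT : ∀ ℏ ∈ Set.Ioo (0 : ℝ) hstar,
      T ℏ = 2 * Real.sqrt 2 * ∫ x in (0 : ℝ)..(xp ℏ), (Real.sqrt (ℏ - E x))⁻¹) :
    ∀ ℏ ∈ Set.Ioo (0 : ℝ) hstar,
      T ℏ = 2 * Real.sqrt 2 * ∫ ρ in (0 : ℝ)..1,
        (Real.sqrt (1 - ρ ^ 2))⁻¹ *
          (Real.sqrt (1 / 2 -
            2 * β * V₀ ^ 2 / ((1 - ρ ^ 2 * (xp ℏ) ^ 2) * (1 - (xp ℏ) ^ 2))))⁻¹ := by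
  intro ℏ hℏ
  obtain ⟨⟨ha0, ha⟩, hEa⟩ := hxp ℏ hℏ
  rw [hT ℏ hℏ]
  generalize xp ℏ = a at *
  have ha1 : a < 1 := by
    refine ha.trans_le (hxstar ▸ Real.sqrt_le_one.mpr ?_)
    have := mul_nonneg (mul_nonneg zero_le_two (Real.sqrt_nonneg β)) hV0.le
    linarith
  have scale := intervalIntegral.mul_integral_comp_mul_left (a := 0) (b := 1)
    (f := fun x => (Real.sqrt (ℏ - E x))⁻¹) a
  rw [mul_zero, mul_one] at scale
  rw [← scale, ← intervalIntegral.integral_const_mul]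
  congr 1
  refine intervalIntegral.integral_congr fun ρ hρ => ?_
  rw [Set.uIcc_of_le zero_le_one] at hρ
  have hρ2 : ρ ^ 2 ≤ 1 := pow_le_one₀ hρ.1 hρ.2
  have ha2 : a ^ 2 < 1 := pow_lt_one₀ ha0.le ha1 two_ne_zero
  have h1 : 1 - a ^ 2 ≠ 0 := by linarith
  have h2 : 1 - ρ ^ 2 * a ^ 2 ≠ 0 := by nlinarith [sq_nonneg a]
  have h3 : 1 - a ^ 2 * ρ ^ 2 ≠ 0 := by rwa [mul_comm]
  have key : ℏ - E (a * ρ) = a ^ 2 * ((1 - ρ ^ 2) *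
      (1 / 2 - 2 * β * V₀ ^ 2 / ((1 - ρ ^ 2 * a ^ 2) * (1 - a ^ 2)))) := by
    rw [← hEa, hE, hE, mul_pow]
    field_simp
    ring
  simp only [key]
  rw [Real.sqrt_mul (sq_nonneg a), Real.sqrt_sq ha0.le, Real.sqrt_mul (by linarith),
    mul_inv, mul_inv, mul_inv_cancel_left₀ ha0.ne']
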